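/- Let N ≥ 1 be an integer and p a real with 1 < p < p_*(N). Then there exist constants β > 0 and γ > 0, depending only on N and p, such that every smooth function u : ℝ × EuclideanSpace ℝ (Fin N) → ℝ with u > 0 everywhere and ∂_t u = Δu + u^p on all of ℝ × ℝ^N satisfies, at every point (t,x): ‖∇u/u‖² − γ·∂_t(log u) + β·u^{p−1} ≤ 0. -/

import Mathlib

open scoped RealInnerProductSpace

/-- Second partial derivative `∂ᵢ∂ⱼ f` with respect to the standard coordinates. -/
noncomputable def pd2 {N : ℕ} (f : EuclideanSpace ℝ (Fin N) → ℝ) (i j : Fin N)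
    (x : EuclideanSpace ℝ (Fin N)) : ℝ :=
  fderiv ℝ (fun y => fderiv ℝ f y (EuclideanSpace.single i 1)) x (EuclideanSpace.single j 1)

/-- Laplacian: sum of the second partial derivatives `∂ᵢ∂ᵢ f`. -/
noncomputable def lap {N : ℕ} (f : EuclideanSpace ℝ (Fin N) → ℝ)
    (x : EuclideanSpace ℝ (Fin N)) : ℝ :=
  ∑ i, pd2 f i i x

/-- Spatial gradient of a function of `(t, x)`. -/
noncomputable def sgrad {N : ℕ} (u : ℝ × EuclideanSpace ℝ (Fin N) → ℝ) (t : ℝ)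
    (x : EuclideanSpace ℝ (Fin N)) : EuclideanSpace ℝ (Fin N) :=
  gradient (fun y => u (t, y)) x

/-- Spatial second partial derivative of a function of `(t, x)`. -/
noncomputable def spd2 {N : ℕ} (u : ℝ × EuclideanSpace ℝ (Fin N) → ℝ) (i j : Fin N) (t : ℝ)
    (x : EuclideanSpace ℝ (Fin N)) : ℝ :=
  pd2 (fun y => u (t, y)) i j x

/-- Spatial Laplacian of a function of `(t, x)`. -/
noncomputable def slap {N : ℕ} (u : ℝ × EuclideanSpace ℝ (Fin N) → ℝ) (t : ℝ)
    (x : EuclideanSpace ℝ (Fin N)) : ℝ :=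
  lap (fun y => u (t, y)) x

/-- Time derivative `∂ₜ u` of a function of `(t, x)`. -/
noncomputable def partialT {N : ℕ} (u : ℝ × EuclideanSpace ℝ (Fin N) → ℝ) (t : ℝ)
    (x : EuclideanSpace ℝ (Fin N)) : ℝ :=
  deriv (fun s => u (s, x)) t

/-- The critical exponent `p_*(N)`. -/
noncomputable def pStar (N : ℕ) : ℝ :=
  if 2 ≤ N then ((N : ℝ) + 2 + Real.sqrt ((N : ℝ) ^ 2 + 8 * N)) / (2 * ((N : ℝ) - 1)) else 8


namespace LY
open MeasureTheory

abbrev V (N : ℕ) := ℝ × EuclideanSpace ℝ (Fin N)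

abbrev Sm {N : ℕ} (f : V N → ℝ) : Prop := ContDiff ℝ (⊤ : ℕ∞) f

noncomputable def dD {N : ℕ} (v : V N) (f : V N → ℝ) : V N → ℝ := fun z => fderiv ℝ f z v

noncomputable def e {N : ℕ} (i : Fin N) : V N := (0, EuclideanSpace.single i 1)
noncomputable def e0 {N : ℕ} : V N := (1, 0)

variable {N : ℕ}

lemma Sm.dD {f : V N → ℝ} (hf : Sm f) (v : V N) : Sm (dD v f) := by
  unfold LY.dD
  exact (hf.fderiv_right (m := (⊤ : ℕ∞)) (by simp)).clm_apply contDiff_const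

lemma Sm.dA {f : V N → ℝ} (hf : Sm f) (z : V N) : DifferentiableAt ℝ f z :=
  hf.contDiffAt.differentiableAt (by simp)

lemma dD_mul {f g : V N → ℝ} (hf : Sm f) (hg : Sm g) (v z : V N) :
    dD v (fun z => f z * g z) z = f z * dD v g z + dD v f z * g z := by
  unfold dD
  rw [fderiv_fun_mul (hf.dA z) (hg.dA z)]
  simp [mul_comm]

lemma dD_sub {f g : V N → ℝ} (hf : Sm f) (hg : Sm g) (v z : V N) :
    dD v (fun z => f z - g z) z = dD v f z - dD v g z := by
  unfold dD
  rw [fderiv_fun_sub (hf.dA z) (hg.dA z)]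
  simp

lemma dD_sum {ι : Type*} [Fintype ι] {f : ι → V N → ℝ} (hf : ∀ i, Sm (f i)) (v z : V N) :
    dD v (fun z => ∑ i, f i z) z = ∑ i, dD v (f i) z := by
  unfold dD
  rw [fderiv_fun_sum (fun i _ => (hf i).dA z)]
  simp

lemma dD_comp {h : ℝ → ℝ} {h' : ℝ} {f : V N → ℝ} (hf : Sm f) (v z : V N)
    (hh : HasDerivAt h h' (f z)) :
    dD v (fun z => h (f z)) z = h' * dD v f z := by
  unfold dD
  have := (hh.comp_hasFDerivAt z (hf.dA z).hasFDerivAt).fderiv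
  change fderiv ℝ (h ∘ f) z v = _
  rw [this]; simp

lemma dD_comm {f : V N → ℝ} (hf : Sm f) (v w z : V N) :
    dD v (dD w f) z = dD w (dD v f) z := by
  have hs : IsSymmSndFDerivAt ℝ f z :=
    hf.contDiffAt.isSymmSndFDerivAt (by
      rw [minSmoothness_of_isRCLikeNormedField]; exact WithTop.coe_le_coe.2 le_top)
  have hd : DifferentiableAt ℝ (fderiv ℝ f) z :=
    (hf.fderiv_right (m := (⊤ : ℕ∞)) (by simp)).contDiffAt.differentiableAt (by simp)
  have key : ∀ v w : V N, dD v (dD w f) z = fderiv ℝ (fderiv ℝ f) z v w := by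
    intro v w
    unfold dD
    rw [fderiv_clm_apply hd (by fun_prop)]
    simp
  rw [key, key]; exact hs v w

def Null (G : V N → ℝ) : Prop := Integrable G ∧ ∫ z, G z = 0

lemma Null.add {F G : V N → ℝ} (hF : Null F) (hG : Null G) : Null (fun z => F z + G z) :=
  ⟨hF.1.add hG.1, by rw [integral_add hF.1 hG.1, hF.2, hG.2, add_zero]⟩

lemma Null.smul {F : V N → ℝ} (hF : Null F) (c : ℝ) : Null (fun z => c * F z) :=
  ⟨hF.1.const_mul c, by rw [integral_const_mul, hF.2, mul_zero]⟩

lemma Null.sum {ι : Type*} [Fintype ι] {F : ι → V N → ℝ} (hF : ∀ i, Null (F i)) :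
    Null (fun z => ∑ i, F i z) :=
  ⟨integrable_finsetSum _ (fun i _ => (hF i).1), by
    rw [integral_finsetSum _ (fun i _ => (hF i).1)]
    simp [fun i => (hF i).2]⟩

lemma cs_dD {φ : V N → ℝ} (hc : HasCompactSupport φ) (v : V N) : HasCompactSupport (dD v φ) :=
  hc.fderiv_apply (𝕜 := ℝ) v

lemma null_ibp {φ X : V N → ℝ} (hφ : Sm φ) (hc : HasCompactSupport φ) (hX : Sm X) (v : V N) :
    Null (fun z => φ z * dD v X z + dD v φ z * X z) := by
  have h1 : Integrable (fun z => φ z * dD v X z) :=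
    (hφ.continuous.mul (hX.dD v).continuous).integrable_of_hasCompactSupport hc.mul_right
  have h2 : Integrable (fun z => dD v φ z * X z) :=
    ((hφ.dD v).continuous.mul hX.continuous).integrable_of_hasCompactSupport (cs_dD hc v).mul_right
  have h3 : Integrable (fun z => φ z * X z) :=
    (hφ.continuous.mul hX.continuous).integrable_of_hasCompactSupport hc.mul_right
  have : (volume : Measure (V N)).IsAddHaarMeasure :=
    inferInstanceAs (((volume : Measure ℝ).prod
      (volume : Measure (EuclideanSpace ℝ (Fin N)))).IsAddHaarMeasure)
  refine ⟨h1.add h2, ?_⟩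
  rw [integral_add h1 h2]
  have := integral_mul_fderiv_eq_neg_fderiv_mul_of_integrable (μ := (volume : Measure (V N)))
    (f := φ) (g := X) (v := v) h2 h1 h3 (fun x _ => hφ.dA x) (fun x _ => hX.dA x)
  unfold dD
  rw [this]; simp


noncomputable def gr (u : V N → ℝ) (i : Fin N) : V N → ℝ := dD (e i) u
noncomputable def hs (u : V N → ℝ) (i j : Fin N) : V N → ℝ := dD (e j) (dD (e i) u)
noncomputable def zz (u : V N → ℝ) : V N → ℝ := fun z => ∑ i, gr u i z * gr u i z
noncomputable def La (u : V N → ℝ) : V N → ℝ := fun z => ∑ i, hs u i i z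
noncomputable def ta (u : V N → ℝ) : V N → ℝ := dD e0 u

lemma sm_gr {u : V N → ℝ} (hu : Sm u) (i : Fin N) : Sm (gr u i) := hu.dD _
lemma sm_hs {u : V N → ℝ} (hu : Sm u) (i j : Fin N) : Sm (hs u i j) := (hu.dD _).dD _
lemma sm_zz {u : V N → ℝ} (hu : Sm u) : Sm (zz u) :=
  ContDiff.sum fun i _ => (sm_gr hu i).mul (sm_gr hu i)
lemma sm_La {u : V N → ℝ} (hu : Sm u) : Sm (La u) :=
  ContDiff.sum fun i _ => sm_hs hu i i
lemma sm_ta {u : V N → ℝ} (hu : Sm u) : Sm (ta u) := hu.dD _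

lemma hs_symm {u : V N → ℝ} (hu : Sm u) (i j : Fin N) (z : V N) : hs u i j z = hs u j i z :=
  dD_comm hu _ _ z

lemma dD_gr (u : V N → ℝ) (i j : Fin N) : dD (e j) (gr u i) = hs u i j := rfl

lemma dD_zz {u : V N → ℝ} (hu : Sm u) (v z : V N) :
    dD v (zz u) z = 2 * ∑ i, gr u i z * dD v (gr u i) z := by
  unfold zz
  rw [dD_sum (fun i => (sm_gr hu i).mul (sm_gr hu i)), Finset.mul_sum]
  refine Finset.sum_congr rfl fun i _ => ?_
  rw [dD_mul (sm_gr hu i) (sm_gr hu i)]; ring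

/-- Bochner identity -/
lemma null_a {u φ : V N → ℝ} (hu : Sm u) (hφ : Sm φ) (hc : HasCompactSupport φ) :
    Null (fun z => φ z * (∑ i, ∑ j, hs u i j z * hs u i j z - La u z * La u z)
      + ∑ i, gr φ i z * (∑ j, hs u i j z * gr u j z - gr u i z * La u z)) := by
  have sX1 : ∀ i, Sm (fun z => ∑ j, hs u i j z * gr u j z) := fun i =>
    ContDiff.sum fun j _ => (sm_hs hu i j).mul (sm_gr hu j)
  have sX2 : ∀ i, Sm (fun z => gr u i z * La u z) := fun i => (sm_gr hu i).mul (sm_La hu)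
  have := Null.sum (fun i => null_ibp hφ hc
    (X := fun z => ∑ j, hs u i j z * gr u j z - gr u i z * La u z) ((sX1 i).sub (sX2 i)) (e i))
  convert this using 2 with z
  rw [Finset.sum_add_distrib]
  congr 1
  rw [← Finset.mul_sum]
  congr 1
  have h3 : ∀ i, dD (e i) (fun z => ∑ j, hs u i j z * gr u j z - gr u i z * La u z) z
      = ∑ j, (hs u i j z * hs u i j z + dD (e j) (hs u i i) z * gr u j z)
        - (gr u i z * ∑ k, dD (e i) (hs u k k) z + hs u i i z * La u z) := by
    intro i
    rw [dD_sub (sX1 i) (sX2 i), dD_mul (sm_gr hu i) (sm_La hu),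
      dD_sum (fun j => (sm_hs hu i j).mul (sm_gr hu j))]
    congr 1
    · refine Finset.sum_congr rfl fun j _ => ?_
      rw [dD_mul (sm_hs hu i j) (sm_gr hu j), dD_gr, hs_symm hu j i]
      congr 2
      unfold hs
      exact dD_comm (hu.dD _) _ _ z
    · rw [dD_gr]; congr 2
      unfold La
      rw [dD_sum (fun k => sm_hs hu k k)]
  simp_rw [h3, Finset.sum_sub_distrib, Finset.sum_add_distrib, Finset.mul_sum]
  rw [← Finset.sum_mul, Finset.sum_comm (f := fun i j => dD (e j) (hs u i i) z * gr u j z)]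
  have : ∑ i, hs u i i z = La u z := rfl
  rw [this]
  have h4 : ∑ x, ∑ i, gr u x z * dD (e x) (hs u i i) z = ∑ y, ∑ x, dD (e y) (hs u x x) z * gr u y z :=
    Finset.sum_congr rfl fun i _ => Finset.sum_congr rfl fun j _ => mul_comm _ _
  rw [h4]; ring

lemma null_b {u φ : V N → ℝ} (hu : Sm u) (hφ : Sm φ) (hc : HasCompactSupport φ) :
    Null (fun z => 2 * ∑ i, gr φ i z * ∑ j, hs u i j z * gr u j z + La φ z * zz u z) := by
  have := Null.sum (fun i : Fin N => null_ibp (sm_gr hφ i) (cs_dD hc (e i))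
    (sm_zz hu) (e i))
  convert this using 2 with z
  rw [Finset.sum_add_distrib, ← Finset.sum_mul]
  congr 1
  rw [Finset.mul_sum]
  refine Finset.sum_congr rfl fun i _ => ?_
  rw [dD_zz hu, show ∑ j, hs u i j z * gr u j z = ∑ j, gr u j z * dD (e i) (gr u j) z from
    Finset.sum_congr rfl fun j _ => by rw [dD_gr, hs_symm hu, mul_comm]]
  ring

/-- divergence identity for `ω ∇u`. -/
lemma null_div {u φ ω : V N → ℝ} (hu : Sm u) (hφ : Sm φ) (hc : HasCompactSupport φ) (hω : Sm ω) :
    Null (fun z => φ z * (ω z * La u z + ∑ i, gr ω i z * gr u i z)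
      + ω z * ∑ i, gr φ i z * gr u i z) := by
  have := Null.sum (fun i : Fin N => null_ibp hφ hc (hω.mul (sm_gr hu i)) (e i))
  convert this using 2 with z
  rw [Finset.sum_add_distrib, ← Finset.mul_sum, Finset.mul_sum]
  congr 1
  · congr 1
    unfold La
    rw [Finset.mul_sum, ← Finset.sum_add_distrib]
    refine Finset.sum_congr rfl fun i _ => ?_
    rw [dD_mul hω (sm_gr hu i)]; rfl
  · refine Finset.sum_congr rfl fun i _ => ?_
    unfold gr; ring

variable {p : ℝ}

lemma sm_rpow {u : V N → ℝ} (hu : Sm u) (hpos : ∀ z, 0 < u z) (a : ℝ) : Sm (fun z => u z ^ a) :=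
  hu.rpow_const_of_ne fun z => (hpos z).ne'

lemma dD_rpow {u : V N → ℝ} (hu : Sm u) (hpos : ∀ z, 0 < u z) (a : ℝ) (v z : V N) :
    dD v (fun z => u z ^ a) z = a * u z ^ (a - 1) * dD v u z :=
  dD_comp (h := fun x => x ^ a) hu v z (Real.hasDerivAt_rpow_const (Or.inl (hpos z).ne'))

lemma dD_inv {u : V N → ℝ} (hu : Sm u) (hpos : ∀ z, 0 < u z) (v z : V N) :
    dD v (fun z => (u z)⁻¹) z = -(u z ^ 2)⁻¹ * dD v u z :=
  dD_comp (h := fun x => x⁻¹) hu v z (hasDerivAt_inv (hpos z).ne')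

lemma null_c {u φ : V N → ℝ} (hu : Sm u) (hpos : ∀ z, 0 < u z) (hφ : Sm φ)
    (hc : HasCompactSupport φ) :
    Null (fun z => φ z * ((u z)⁻¹ * zz u z * La u z
        + 2 * (u z)⁻¹ * (∑ i, ∑ j, hs u i j z * gr u i z * gr u j z)
        - (u z ^ 2)⁻¹ * zz u z * zz u z)
      + (u z)⁻¹ * zz u z * ∑ i, gr φ i z * gr u i z) := by
  have si : Sm (fun z => (u z)⁻¹) := hu.inv fun z => (hpos z).ne'
  have := null_div hu hφ hc (si.mul (sm_zz hu))
  convert this using 5 with z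
  rw [add_sub_assoc]
  congr 1
  have : ∀ i, gr (fun z => (u z)⁻¹ * zz u z) i z * gr u i z
      = 2 * (u z)⁻¹ * (∑ j, hs u i j z * gr u i z * gr u j z)
        - (u z ^ 2)⁻¹ * zz u z * (gr u i z * gr u i z) := by
    intro i
    unfold gr
    rw [dD_mul si (sm_zz hu), dD_zz hu, dD_inv hu hpos]
    have h : ∑ j, hs u i j z * dD (e i) u z * dD (e j) u z
        = (∑ j, gr u j z * dD (e i) (gr u j) z) * dD (e i) u z := by
      rw [Finset.sum_mul]
      refine Finset.sum_congr rfl fun j _ => ?_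
      rw [dD_gr, hs_symm hu]; unfold gr; ring
    rw [h]; ring
  simp_rw [this, Finset.sum_sub_distrib, ← Finset.mul_sum]
  rfl

lemma null_d {u φ : V N → ℝ} (hu : Sm u) (hpos : ∀ z, 0 < u z) (hφ : Sm φ)
    (hc : HasCompactSupport φ) :
    Null (fun z => φ z * (u z ^ p * La u z + p * u z ^ (p - 1) * zz u z)
      + u z ^ p * ∑ i, gr φ i z * gr u i z) := by
  have := null_div hu hφ hc (sm_rpow hu hpos p)
  convert this using 5 with z
  unfold zz
  rw [Finset.mul_sum]
  refine Finset.sum_congr rfl fun i _ => ?_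
  unfold gr
  rw [dD_rpow hu hpos]; ring

lemma null_e {u φ : V N → ℝ} (hu : Sm u) (hφ : Sm φ) (hc : HasCompactSupport φ) :
    Null (fun z => φ z * (ta u z * La u z)
      + ta u z * (∑ i, gr φ i z * gr u i z) - 1 / 2 * (ta φ z * zz u z)) := by
  have := (null_div hu hφ hc (sm_ta hu)).add ((null_ibp hφ hc (sm_zz hu) e0).smul (-1/2))
  convert this using 2 with z
  rw [dD_zz hu]
  have : ∑ i, gr u i z * dD e0 (gr u i) z = ∑ i, gr (ta u) i z * gr u i z := by
    refine Finset.sum_congr rfl fun i _ => ?_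
    unfold gr ta
    rw [dD_comm hu, mul_comm]
  rw [this]; unfold ta; ring

lemma null_f {u φ : V N → ℝ} (hu : Sm u) (hpos : ∀ z, 0 < u z) (hφ : Sm φ)
    (hc : HasCompactSupport φ) :
    Null (fun z => φ z * ((p + 1) * u z ^ p * ta u z) + ta φ z * u z ^ (p + 1)) := by
  have := null_ibp hφ hc (sm_rpow hu hpos (p+1)) e0
  convert this using 4 with z
  · rw [dD_rpow hu hpos]
    simp [ta]
  · rfl


lemma hess_ineq (hN : 1 ≤ N) (H : Fin N → Fin N → ℝ) (g : Fin N → ℝ) (k : ℝ) :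
    0 ≤ ∑ i, ∑ j, H i j * H i j - 2 * k * (∑ i, ∑ j, H i j * g i * g j)
      + k ^ 2 * (∑ i, g i * g i) ^ 2 - (∑ i, H i i - k * ∑ i, g i * g i) ^ 2 / N := by
  have hN' : (0 : ℝ) < N := by exact_mod_cast hN
  have h1 : ∑ i, ∑ j, (H i j - k * (g i * g j)) ^ 2
      = ∑ i, ∑ j, H i j * H i j - 2 * k * (∑ i, ∑ j, H i j * g i * g j)
      + k ^ 2 * (∑ i, g i * g i) ^ 2 := by
    rw [pow_two (∑ i, g i * g i), Finset.sum_mul_sum]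
    simp_rw [Finset.mul_sum]
    rw [← Finset.sum_sub_distrib, ← Finset.sum_add_distrib]
    refine Finset.sum_congr rfl fun i _ => ?_
    rw [← Finset.sum_sub_distrib, ← Finset.sum_add_distrib]
    refine Finset.sum_congr rfl fun j _ => ?_
    ring
  have h2 : (∑ i, H i i - k * ∑ i, g i * g i) ^ 2
      ≤ N * ∑ i, (H i i - k * (g i * g i)) ^ 2 := by
    rw [Finset.mul_sum, ← Finset.sum_sub_distrib]
    have := sq_sum_le_card_mul_sum_sq (s := (Finset.univ : Finset (Fin N)))
      (f := fun i => H i i - k * (g i * g i))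
    simpa using this
  have h3 : ∑ i, (H i i - k * (g i * g i)) ^ 2 ≤ ∑ i, ∑ j, (H i j - k * (g i * g j)) ^ 2 := by
    refine Finset.sum_le_sum fun i _ => ?_
    exact Finset.single_le_sum (f := fun j => (H i j - k * (g i * g j)) ^ 2)
      (fun j _ => sq_nonneg _) (Finset.mem_univ i)
  have h4 : (∑ i, H i i - k * ∑ i, g i * g i) ^ 2 / N ≤ ∑ i, (H i i - k * (g i * g i)) ^ 2 := by
    rw [div_le_iff₀ hN']; linarith
  linarith

/-- The algebraic combination. -/
lemma alg1 (n p s : ℝ) (hp : 1 < p) (hn : 1 ≤ n) (hs0 : 0 < s)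
    (hs1 : s * (n - 1) < n) (hs2 : p * (n - 1) < s * (n + 2)) :
    ∃ c C k1 k2 k3 : ℝ, 0 < c ∧ 0 ≤ C ∧ ∀ φ h2 S y u τ U Λ P W L T a b cc d ee f : ℝ,
      0 ≤ φ → 0 ≤ y → 0 < u → 0 < U → Λ = τ - U →
      0 ≤ h2 - 2 * (s / u) * S + (s / u) ^ 2 * (u * y) ^ 2 - (Λ - (s / u) * (u * y)) ^ 2 / n →
      a = φ * (h2 - Λ * Λ) + (W - Λ * P) →
      b = 2 * W + L * (u * y) →
      cc = φ * (y * Λ + 2 * u⁻¹ * S - y * y) + y * P →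
      d = φ * (U * Λ + p * (U * y)) + U * P →
      ee = φ * (τ * Λ) + τ * P - 1 / 2 * (T * (u * y)) →
      f = φ * ((p + 1) * U * τ) + T * (u * U) →
      c * (φ * (y ^ 2 + τ ^ 2 + U ^ 2)) ≤
        (a - b / 2 - s * cc) + k1 * d + k2 * ee + k3 * f
        + C * (|P| * (U + |τ| + y) + (|L| + |T|) * (u * y) + |T| * (u * U)) := by
  have hn0 : 0 < n := by linarith
  set ν := (n - 1) / n with hν
  have hν0 : 0 ≤ ν := div_nonneg (by linarith) hn0.le
  have hν1 : ν ≤ 1 := by rw [hν, div_le_one hn0]; linarith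
  have hνn : 1 / n = 1 - ν := by rw [hν]; field_simp; ring
  obtain ⟨c1, hc1⟩ : ∃ c1, c1 = s - s ^ 2 * ν := ⟨_, rfl⟩
  obtain ⟨c2, hc2⟩ : ∃ c2, c2 = s * (1 + 2 / n) := ⟨_, rfl⟩
  obtain ⟨c3, hc3⟩ : ∃ c3, c3 = c2 - p * ν := ⟨_, rfl⟩
  have hc1p : 0 < c1 := by
    have : c1 = s * (n - s * (n - 1)) / n := by rw [hc1, hν]; field_simp
    rw [this]; apply div_pos (mul_pos hs0 (by linarith)) hn0
  have hc2p : 0 < c2 := by rw [hc2]; positivity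
  have hc3p : 0 < c3 := by
    have : c3 = (s * (n + 2) - p * (n - 1)) / n := by rw [hc3, hc2, hν]; field_simp
    rw [this]; apply div_pos (by linarith) hn0
  have hp0 : 0 < p := by linarith
  obtain ⟨q, hq⟩ : ∃ q, q = c3 / (2 * p) := ⟨_, rfl⟩
  have hqp : 0 < q := by rw [hq]; positivity
  have hqc : q * p = c3 / 2 := by rw [hq]; field_simp
  obtain ⟨A, hA⟩ : ∃ A, A = c2 ^ 2 / (2 * c1) := ⟨_, rfl⟩
  have hAp : 0 < A := by rw [hA]; positivity
  obtain ⟨B, hB⟩ : ∃ B, B = A + q + 1 := ⟨_, rfl⟩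
  have hBp : 0 < B := by rw [hB]; positivity
  refine ⟨min (c1 / 2) (min 1 (q / 2)), 1 + q + s + B + 1, -ν - q, ν + q + B, B / (p + 1),
    by positivity, by positivity, ?_⟩
  intro φ h2 S y u τ U Λ P W L T a b cc d ee f hφ hy hu hU hΛ hQ ha hb hcc hd hee hf
  -- Hessian
  have hQ' : 0 ≤ φ * (h2 - 2 * s * (u⁻¹ * S) + s ^ 2 * ν * y ^ 2 - (1 - ν) * Λ ^ 2
      + (2 * s / n) * (y * Λ)) := by
    apply mul_nonneg hφ
    refine hQ.trans_eq ?_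
    have e1 : s / u * (u * y) = s * y := by field_simp
    have e2 : (s / u) ^ 2 * (u * y) ^ 2 = (s * y) ^ 2 := by rw [← mul_pow, e1]
    have e3 : (Λ - s * y) ^ 2 / n = (1 - ν) * (Λ - s * y) ^ 2 := by rw [← hνn]; ring
    have e4 : 2 * s / n = 2 * s * (1 - ν) := by rw [← hνn]; ring
    rw [e1, e2, e3, e4]; ring
  -- (I)
  have hc2' : c2 = s + 2 * s / n := by rw [hc2]; ring
  have hφΛ : φ * Λ ^ 2 = ee - d + φ * (p * (U * y)) - Λ * P + 1 / 2 * (T * (u * y)) := by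
    rw [hee, hd, hΛ]; ring
  have I1 : 0 ≤ (a - b / 2 - s * cc) + ν * (φ * Λ ^ 2) - c1 * (φ * y ^ 2) + c2 * (φ * (y * Λ))
      + Λ * P + 1 / 2 * (L * (u * y)) + s * (y * P) := by
    rw [hc2', hc1]
    refine hQ'.trans (le_of_eq ?_)
    rw [ha, hb, hcc]; ring
  have hτ : φ * τ ^ 2 = ee - τ * P + 1 / 2 * (T * (u * y)) + f / (p + 1)
      - T * (u * U) / (p + 1) := by
    rw [hee, hf, hΛ]; field_simp; ring
  have hyτ : c2 * (φ * (y * τ)) ≤ c1 / 2 * (φ * y ^ 2) + A * (φ * τ ^ 2) := by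
    have : c1 / 2 * (φ * y ^ 2) + A * (φ * τ ^ 2) - c2 * (φ * (y * τ))
        = φ * (c1 * y - c2 * τ) ^ 2 / (2 * c1) := by
      rw [hA]; field_simp; ring
    have h : 0 ≤ φ * (c1 * y - c2 * τ) ^ 2 / (2 * c1) := by positivity
    linarith
  have hU2 : φ * U ^ 2 ≤ 2 * (φ * τ ^ 2) + 2 * (φ * Λ ^ 2) := by
    have : 2 * (φ * τ ^ 2) + 2 * (φ * Λ ^ 2) - φ * U ^ 2 = φ * (2 * τ - U) ^ 2 := by
      rw [hΛ]; ring
    have h : 0 ≤ φ * (2 * τ - U) ^ 2 := by positivity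
    linarith
  have hU2' := mul_le_mul_of_nonneg_left hU2 (show 0 ≤ q / 2 by positivity)
  have hUy : 0 ≤ φ * (U * y) := by positivity
  -- main sum
  have main : c1 / 2 * (φ * y ^ 2) + φ * τ ^ 2 + q / 2 * (φ * U ^ 2) ≤
      (a - b / 2 - s * cc) + (-ν - q) * d + (ν + q + B) * ee + B / (p + 1) * f
      + ((1 - ν - q) * (Λ * P) + 1 / 2 * (L * (u * y)) + s * (y * P)
        + (ν + q + B) / 2 * (T * (u * y)) - B * (τ * P) - B / (p + 1) * (T * (u * U))) := by
    have e1 : c2 * (φ * (y * Λ)) = c2 * (φ * (y * τ)) - c2 * (φ * (U * y)) := by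
      rw [hΛ]; ring
    have e2 : B * (φ * τ ^ 2) = A * (φ * τ ^ 2) + q * (φ * τ ^ 2) + φ * τ ^ 2 := by
      rw [hB]; ring
    have e3 : B * (φ * τ ^ 2) = B * ee - B * (τ * P) + B / 2 * (T * (u * y)) + B / (p + 1) * f
      - B / (p + 1) * (T * (u * U)) := by rw [hτ]; ring
    have e4 : (ν + q) * (φ * Λ ^ 2) = (ν + q) * ee - (ν + q) * d + (p * ν + q * p) * (φ * (U * y))
        - (ν + q) * (Λ * P) + (ν + q) / 2 * (T * (u * y)) := by rw [hφΛ]; ring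
    have e5 : (p * ν + q * p) * (φ * (U * y)) = c2 * (φ * (U * y)) - c3 / 2 * (φ * (U * y)) := by
      rw [hqc, hc3]; ring
    have e6 : 0 ≤ c3 / 2 * (φ * (U * y)) := by positivity
    linarith
  have hX : 0 ≤ φ * y ^ 2 := by positivity
  have hY : 0 ≤ φ * τ ^ 2 := by positivity
  have hZ : 0 ≤ φ * U ^ 2 := by positivity
  have l1 := mul_le_mul_of_nonneg_right (min_le_left (c1 / 2) (min 1 (q / 2))) hX
  have l2 := mul_le_mul_of_nonneg_right
    ((min_le_right (c1 / 2) (min 1 (q / 2))).trans (min_le_left _ _)) hY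
  have l3 := mul_le_mul_of_nonneg_right
    ((min_le_right (c1 / 2) (min 1 (q / 2))).trans (min_le_right _ _)) hZ
  have huy : 0 ≤ u * y := by positivity
  have huU : 0 ≤ u * U := by positivity
  have hP := abs_nonneg P
  have hT := abs_nonneg T
  have hL := abs_nonneg L
  have hτa := abs_nonneg τ
  have gen : ∀ k x M X : ℝ, |k| ≤ M → |x| ≤ X → k * x ≤ M * X := by
    intro k x M X hk hx
    calc k * x ≤ |k * x| := le_abs_self _
      _ = |k| * |x| := abs_mul _ _
      _ ≤ M * X := mul_le_mul hk hx (abs_nonneg _) ((abs_nonneg _).trans hk)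
  have t1 : (1 - ν - q) * (Λ * P) ≤ (1 + q) * (|P| * (U + |τ|)) := by
    apply gen
    · rw [abs_le]; constructor <;> linarith
    · rw [abs_mul, mul_comm]
      apply mul_le_mul_of_nonneg_left _ hP
      rw [hΛ, add_comm]
      refine (abs_sub _ _).trans ?_
      rw [abs_of_pos hU]
  have t2 : 1 / 2 * (L * (u * y)) ≤ 1 * (|L| * (u * y)) := by
    apply gen
    · rw [abs_of_pos] <;> norm_num
    · rw [abs_mul, abs_of_nonneg huy]
  have t3 : s * (y * P) ≤ s * (|P| * y) := by
    apply gen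
    · rw [abs_of_pos hs0]
    · rw [abs_mul, abs_of_nonneg hy, mul_comm]
  have t4 : (ν + q + B) / 2 * (T * (u * y)) ≤ (1 + q + B) * (|T| * (u * y)) := by
    apply gen
    · rw [abs_of_pos] <;> linarith
    · rw [abs_mul, abs_of_nonneg huy]
  have t5 : (-B) * (τ * P) ≤ B * (|P| * |τ|) := by
    apply gen
    · rw [abs_neg, abs_of_pos hBp]
    · rw [abs_mul, mul_comm]
  have t6 : (-(B / (p + 1))) * (T * (u * U)) ≤ B * (|T| * (u * U)) := by
    apply gen
    · rw [abs_neg, abs_of_pos (by positivity)]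
      apply div_le_self hBp.le; linarith
    · rw [abs_mul, abs_of_nonneg huU]
  have p1 : 0 ≤ |P| * U := by positivity
  have p2 : 0 ≤ |P| * |τ| := by positivity
  have p3 : 0 ≤ |P| * y := by positivity
  have p4 : 0 ≤ |L| * (u * y) := by positivity
  have p5 : 0 ≤ |T| * (u * y) := by positivity
  have p6 : 0 ≤ |T| * (u * U) := by positivity
  have fin : (1 + q) * (|P| * (U + |τ|)) + 1 * (|L| * (u * y)) + s * (|P| * y)
      + (1 + q + B) * (|T| * (u * y)) + B * (|P| * |τ|) + B * (|T| * (u * U))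
      ≤ (1 + q + s + B + 1) * (|P| * (U + |τ| + y) + (|L| + |T|) * (u * y) + |T| * (u * U)) := by
    have : (1 + q + s + B + 1) * (|P| * (U + |τ| + y) + (|L| + |T|) * (u * y) + |T| * (u * U))
      - ((1 + q) * (|P| * (U + |τ|)) + 1 * (|L| * (u * y)) + s * (|P| * y)
      + (1 + q + B) * (|T| * (u * y)) + B * (|P| * |τ|) + B * (|T| * (u * U)))
      = (s + B + 1) * (|P| * U) + (s + 1) * (|P| * |τ|) + (1 + q + B + 1) * (|P| * y)
      + (q + s + B + 1) * (|L| * (u * y)) + (s + 1) * (|T| * (u * y))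
      + (1 + q + s + 1) * (|T| * (u * U)) := by ring
    have h : 0 ≤ (s + B + 1) * (|P| * U) + (s + 1) * (|P| * |τ|) + (1 + q + B + 1) * (|P| * y)
      + (q + s + B + 1) * (|L| * (u * y)) + (s + 1) * (|T| * (u * y))
      + (1 + q + s + 1) * (|T| * (u * U)) := by positivity
    linarith
  rw [mul_add φ, mul_add φ, mul_add, mul_add]
  linarith

lemma alg2 (K ε : ℝ) (hε : 0 < ε) : ∃ C, 0 ≤ C ∧ ∀ U V y ξ r : ℝ, 0 ≤ y →
    r ^ 2 = ξ * y →
    K * r * (U + V + y) + (K + K) * (ξ * y) + K * (ξ * U)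
      ≤ ε * (y ^ 2 + V ^ 2 + U ^ 2) + C * ξ ^ 2 := by
  obtain ⟨M, hM⟩ : ∃ M, M = 3 * K ^ 2 / ε + 2 * K := ⟨_, rfl⟩
  refine ⟨M ^ 2 / ε + K ^ 2 / ε, by positivity, ?_⟩
  intro U V y ξ r hy hr
  have h1 : K * r * (U + V + y) ≤ ε / 12 * (U + V + y) ^ 2 + 3 * K ^ 2 / ε * r ^ 2 := by
    have : ε / 12 * (U + V + y) ^ 2 + 3 * K ^ 2 / ε * r ^ 2 - K * r * (U + V + y)
      = (ε * (U + V + y) - 6 * K * r) ^ 2 / (12 * ε) := by field_simp; ring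
    have h : 0 ≤ (ε * (U + V + y) - 6 * K * r) ^ 2 / (12 * ε) := by positivity
    linarith
  have h2 : (U + V + y) ^ 2 ≤ 3 * (y ^ 2 + V ^ 2 + U ^ 2) := by
    nlinarith [sq_nonneg (U - V), sq_nonneg (U - y), sq_nonneg (V - y)]
  have h2' := mul_le_mul_of_nonneg_left h2 (show 0 ≤ ε / 12 by positivity)
  have y1 : ∀ k x w : ℝ, k * (x * w) ≤ ε / 4 * w ^ 2 + k ^ 2 / ε * x ^ 2 := by
    intro k x w
    have : ε / 4 * w ^ 2 + k ^ 2 / ε * x ^ 2 - k * (x * w) = (ε * w - 2 * k * x) ^ 2 / (4 * ε) := by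
      field_simp; ring
    have h : 0 ≤ (ε * w - 2 * k * x) ^ 2 / (4 * ε) := by positivity
    linarith
  have h3 := y1 M ξ y
  have h4 := y1 K ξ U
  rw [hr] at h1
  have h5 : M * (ξ * y) = 3 * K ^ 2 / ε * (ξ * y) + (K + K) * (ξ * y) := by rw [hM]; ring
  have : 0 ≤ ε * V ^ 2 := by positivity
  have : 0 ≤ ε * U ^ 2 := by positivity
  have : 0 ≤ ε * y ^ 2 := by positivity
  nlinarith

/-- Young's inequality with a power of the cutoff. -/
lemma alg3 (p : ℝ) (hp : 1 < p) (m : ℕ) (hm : 4 * p / (p - 1) ≤ m) (ε : ℝ) (hε : 0 < ε) :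
    ∃ C, 0 ≤ C ∧ ∀ u ρ ψ : ℝ, 0 < u → 0 < ρ → 0 < ψ → ψ ≤ 1 →
      ψ ^ m * (ρ ^ 2 * u / ψ ^ 2) ^ 2 ≤ ε * (ψ ^ m * (u ^ p) ^ 2) + C * ρ ^ (4 * p / (p - 1)) := by
  have hp1 : 0 < p - 1 := by linarith
  refine ⟨(1 / ε) ^ (1 / (p - 1)), by positivity, ?_⟩
  intro u ρ ψ hu hρ hψ hψ1
  obtain ⟨b, hb⟩ : ∃ b, b = (ρ / ψ) ^ 4 := ⟨_, rfl⟩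
  have hb0 : 0 < b := by rw [hb]; positivity
  have e1 : (ρ ^ 2 * u / ψ ^ 2) ^ 2 = u ^ 2 * b := by rw [hb]; field_simp
  have e2 : (u ^ p) ^ 2 = u ^ 2 * (u ^ 2) ^ (p - 1) := by
    rw [← Real.rpow_natCast, ← Real.rpow_natCast, ← Real.rpow_mul hu.le, ← Real.rpow_mul hu.le,
      ← Real.rpow_add hu]
    congr 1; push_cast; ring
  have hC : 0 ≤ (1 / ε) ^ (1 / (p - 1)) * ρ ^ (4 * p / (p - 1)) := by positivity
  rw [e1]
  rcases le_total b (ε * (u ^ 2) ^ (p - 1)) with h | h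
  · have : ψ ^ m * (u ^ 2 * b) ≤ ε * (ψ ^ m * (u ^ p) ^ 2) := by
      rw [e2]
      calc ψ ^ m * (u ^ 2 * b) ≤ ψ ^ m * (u ^ 2 * (ε * (u ^ 2) ^ (p - 1))) := by gcongr
        _ = _ := by ring
    linarith
  · have h1 : u ^ 2 ≤ (1 / ε) ^ (1 / (p - 1)) * b ^ (1 / (p - 1)) := by
      rw [← Real.mul_rpow (by positivity) hb0.le]
      have : (u ^ 2) ^ (p - 1) ≤ 1 / ε * b := by
        rw [one_div, ← div_eq_inv_mul, le_div_iff₀ hε]; linarith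
      calc u ^ 2 = ((u ^ 2) ^ (p - 1)) ^ (1 / (p - 1)) := by
            rw [← Real.rpow_mul (by positivity), mul_one_div_cancel hp1.ne', Real.rpow_one]
        _ ≤ _ := Real.rpow_le_rpow (by positivity) this (by positivity)
    have h2 : b ^ (1 / (p - 1)) * b = ρ ^ (4 * p / (p - 1)) / ψ ^ (4 * p / (p - 1)) := by
      rw [← Real.div_rpow hρ.le hψ.le]
      nth_rw 2 [← Real.rpow_one b]
      rw [← Real.rpow_add hb0, hb, ← Real.rpow_natCast, ← Real.rpow_mul (by positivity)]
      congr 1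
      push_cast; field_simp; ring
    have h3 : ψ ^ m ≤ ψ ^ (4 * p / (p - 1)) := by
      rw [← Real.rpow_natCast]
      exact Real.rpow_le_rpow_of_exponent_ge hψ hψ1 hm
    have h4 : ψ ^ m * (u ^ 2 * b) ≤ (1 / ε) ^ (1 / (p - 1)) * ρ ^ (4 * p / (p - 1)) := by
      have hψθ : 0 < ψ ^ (4 * p / (p - 1)) := by positivity
      calc ψ ^ m * (u ^ 2 * b)
          ≤ ψ ^ (4 * p / (p - 1)) * ((1 / ε) ^ (1 / (p - 1)) * b ^ (1 / (p - 1)) * b) := by gcongr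
        _ = ψ ^ (4 * p / (p - 1)) * ((1 / ε) ^ (1 / (p - 1)) * (b ^ (1 / (p - 1)) * b)) := by ring
        _ = _ := by rw [h2]; field_simp
    have : 0 ≤ ε * (ψ ^ m * (u ^ p) ^ 2) := by positivity
    linarith


lemma core (hN : 1 ≤ N) (p s : ℝ) (hp : 1 < p) (hs0 : 0 < s)
    (hs1 : s * ((N : ℝ) - 1) < N) (hs2 : p * ((N : ℝ) - 1) < s * (N + 2)) :
    ∃ c C : ℝ, 0 < c ∧ 0 ≤ C ∧ ∀ u φ : V N → ℝ, Sm u → (∀ z, 0 < u z) →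
      (∀ z, ta u z = La u z + u z ^ p) → Sm φ → HasCompactSupport φ → (∀ z, 0 ≤ φ z) →
      ∃ G : V N → ℝ, Null G ∧ ∀ z,
        c * (φ z * ((zz u z / u z) ^ 2 + (ta u z) ^ 2 + (u z ^ p) ^ 2)) ≤
        G z + C * (|∑ i, gr φ i z * gr u i z| * (u z ^ p + |ta u z| + zz u z / u z)
          + (|La φ z| + |ta φ z|) * zz u z + |ta φ z| * (u z * u z ^ p)) := by
  obtain ⟨c, C, k1, k2, k3, hc, hC, H⟩ := alg1 N p s hp (by exact_mod_cast hN) hs0 hs1 hs2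
  refine ⟨c, C, hc, hC, ?_⟩
  intro u φ hu hpos hsol hφ hcs hφ0
  have na := null_a hu hφ hcs
  have nb := null_b hu hφ hcs
  have nc := null_c hu hpos hφ hcs
  have nd := null_d (p := p) hu hpos hφ hcs
  have ne := null_e hu hφ hcs
  have nf := null_f (p := p) hu hpos hφ hcs
  refine ⟨_, ((((na.add (nb.smul (-1 / 2))).add (nc.smul (-s))).add (nd.smul k1)).add
    (ne.smul k2)).add (nf.smul k3), ?_⟩
  intro z
  have huz := hpos z
  have hzz : 0 ≤ zz u z := Finset.sum_nonneg fun i _ => mul_self_nonneg _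
  have huy : u z * (zz u z / u z) = zz u z := by field_simp
  have key := H (φ z) (∑ i, ∑ j, hs u i j z * hs u i j z)
    (∑ i, ∑ j, hs u i j z * gr u i z * gr u j z) (zz u z / u z) (u z) (ta u z) (u z ^ p) (La u z)
    (∑ i, gr φ i z * gr u i z) (∑ i, gr φ i z * ∑ j, hs u i j z * gr u j z) (La φ z) (ta φ z)
    _ _ _ _ _ _ (hφ0 z) (by positivity) huz (by positivity) (by rw [hsol]; ring)
    (by
      have := hess_ineq hN (fun i j => hs u i j z) (fun i => gr u i z) (s / u z)
      rw [huy]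
      exact this)
    rfl rfl rfl rfl rfl rfl
  rw [huy] at key
  refine key.trans (le_of_eq ?_)
  congr 1
  have e1 : ∑ i, gr φ i z * (∑ j, hs u i j z * gr u j z - gr u i z * La u z)
    = ∑ i, gr φ i z * ∑ j, hs u i j z * gr u j z - La u z * ∑ i, gr φ i z * gr u i z := by
    rw [Finset.mul_sum, ← Finset.sum_sub_distrib]
    exact Finset.sum_congr rfl fun i _ => by ring
  have e2 : u z ^ p * (zz u z / u z) = u z ^ (p - 1) * zz u z := by
    rw [Real.rpow_sub_one huz.ne']; ring
  have e3 : u z ^ (p + 1) = u z * u z ^ p := by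
    rw [Real.rpow_add_one huz.ne', mul_comm]
  rw [e1, e2, e3]
  field_simp
  ring

/-- anisotropic scaling -/
noncomputable def Asc (ρ : ℝ) : V N →L[ℝ] V N :=
  (ρ ^ 2 • ContinuousLinearMap.id ℝ ℝ).prodMap
    (ρ • ContinuousLinearMap.id ℝ (EuclideanSpace ℝ (Fin N)))

lemma Asc_apply (ρ : ℝ) (z : V N) : Asc ρ z = (ρ ^ 2 * z.1, ρ • z.2) := by
  unfold Asc
  rfl

lemma dD_Asc {f : V N → ℝ} (hf : Sm f) (ρ : ℝ) (v z : V N) :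
    dD v (fun z => f (Asc ρ z)) z = dD (Asc ρ v) f (Asc ρ z) := by
  unfold dD
  have := ((hf.dA (Asc ρ z)).hasFDerivAt.comp z (Asc ρ).hasFDerivAt).fderiv
  change fderiv ℝ (f ∘ (Asc ρ)) z v = _
  rw [this]; rfl

lemma dD_smul (f : V N → ℝ) (a : ℝ) (v z : V N) : dD (a • v) f z = a * dD v f z := by
  unfold dD; simp

lemma Asc_e (ρ : ℝ) (i : Fin N) : Asc ρ (e i) = ρ • (e i : V N) := by
  rw [Asc_apply]; simp [e]

lemma Asc_e0 (ρ : ℝ) : Asc ρ (e0) = ρ ^ 2 • (e0 : V N) := by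
  rw [Asc_apply]; simp [e0]

lemma dD_const_mul {f : V N → ℝ} (hf : Sm f) (a : ℝ) (v z : V N) :
    dD v (fun z => a * f z) z = a * dD v f z := by
  unfold dD
  rw [fderiv_const_mul (hf.dA z)]; simp

lemma cutoff (N : ℕ) : ∃ B : ℝ, 0 ≤ B ∧ ∀ ρ : ℝ, 0 < ρ → ρ ≤ 1 → ∃ ψ : V N → ℝ,
    Sm ψ ∧ HasCompactSupport ψ ∧ (∀ z, 0 ≤ ψ z) ∧ (∀ z, ψ z ≤ 1) ∧
    (∀ z, z ∈ Metric.closedBall (0 : V N) 1 → ψ z = 1) ∧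
    (∀ z, ψ z ≠ 0 → z ∈ (Metric.closedBall (0 : ℝ) (2 / ρ ^ 2)) ×ˢ
      (Metric.closedBall (0 : EuclideanSpace ℝ (Fin N)) (2 / ρ))) ∧
    (∀ i z, |gr ψ i z| ≤ B * ρ) ∧ (∀ z, |ta ψ z| ≤ B * ρ ^ 2) ∧
    (∀ i z, |hs ψ i i z| ≤ B * ρ ^ 2) := by
  let b : ContDiffBump (0 : V N) := ⟨1, 2, one_pos, by norm_num⟩
  have sb : Sm (b : V N → ℝ) := b.contDiff
  have cb : HasCompactSupport (b : V N → ℝ) := b.hasCompactSupport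
  have bd : ∀ f : V N → ℝ, Sm f → HasCompactSupport f → ∃ C, ∀ z, |f z| ≤ C := by
    intro f hf hc
    obtain ⟨C, hC⟩ := hc.exists_bound_of_continuous hf.continuous
    exact ⟨C, fun z => by simpa using hC z⟩
  choose B1 hB1 using fun i : Fin N => bd (gr b i) (sm_gr sb i) (cs_dD cb _)
  obtain ⟨B2, hB2⟩ := bd (ta b) (sm_ta sb) (cs_dD cb _)
  choose B3 hB3 using fun i : Fin N => bd (hs b i i) (sm_hs sb i i) (cs_dD (cs_dD cb _) _)
  have p1 : ∀ i, 0 ≤ B1 i := fun i => (abs_nonneg _).trans (hB1 i 0)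
  have p2 : 0 ≤ B2 := (abs_nonneg _).trans (hB2 0)
  have p3 : ∀ i, 0 ≤ B3 i := fun i => (abs_nonneg _).trans (hB3 i 0)
  have s1 : 0 ≤ ∑ i, B1 i := Finset.sum_nonneg fun i _ => p1 i
  have s3 : 0 ≤ ∑ i, B3 i := Finset.sum_nonneg fun i _ => p3 i
  refine ⟨∑ i, B1 i + B2 + ∑ i, B3 i, by positivity, ?_⟩
  intro ρ hρ hρ1
  have sψ : Sm (fun z : V N => b (Asc ρ z)) := sb.comp (Asc ρ).contDiff
  have g1 : ∀ i z, gr (fun z : V N => b (Asc ρ z)) i z = ρ * gr b i (Asc ρ z) := by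
    intro i z
    unfold gr
    rw [dD_Asc sb, Asc_e, dD_smul]
  have supp : ∀ z : V N, b (Asc ρ z) ≠ 0 → z ∈ (Metric.closedBall (0 : ℝ) (2 / ρ ^ 2)) ×ˢ
      (Metric.closedBall (0 : EuclideanSpace ℝ (Fin N)) (2 / ρ)) := by
    intro z hz
    have hz' : Asc ρ z ∈ Metric.ball (0 : V N) 2 := by
      have : Asc ρ z ∈ Function.support b := hz
      rwa [b.support_eq] at this
    rw [mem_ball_zero_iff, Asc_apply, Prod.norm_mk, max_lt_iff, norm_mul, norm_smul,
      Real.norm_of_nonneg hρ.le, Real.norm_of_nonneg (sq_nonneg ρ)] at hz'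
    refine ⟨?_, ?_⟩
    · rw [mem_closedBall_zero_iff, le_div_iff₀ (by positivity)]; linarith [hz'.1]
    · rw [mem_closedBall_zero_iff, le_div_iff₀ (by positivity)]; linarith [hz'.2]
  refine ⟨fun z => b (Asc ρ z), sψ, ?_, fun z => b.nonneg, fun z => b.le_one, ?_, supp, ?_, ?_, ?_⟩
  · refine HasCompactSupport.intro ((isCompact_closedBall (0 : ℝ) (2 / ρ ^ 2)).prod
      (isCompact_closedBall (0 : EuclideanSpace ℝ (Fin N)) (2 / ρ))) ?_
    intro z hz
    by_contra h
    exact hz (supp z h)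
  · intro z hz
    apply b.one_of_mem_closedBall
    change Asc ρ z ∈ Metric.closedBall (0 : V N) 1
    rw [mem_closedBall_zero_iff, Prod.norm_def, max_le_iff] at hz
    rw [mem_closedBall_zero_iff, Asc_apply, Prod.norm_mk, max_le_iff, norm_mul, norm_smul,
      Real.norm_of_nonneg hρ.le, Real.norm_of_nonneg (sq_nonneg ρ)]
    exact ⟨mul_le_one₀ (pow_le_one₀ hρ.le hρ1) (norm_nonneg _) hz.1,
      mul_le_one₀ hρ1 (norm_nonneg _) hz.2⟩
  · intro i z
    rw [g1, abs_mul, abs_of_pos hρ, mul_comm]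
    gcongr
    have := Finset.single_le_sum (fun i _ => p1 i) (Finset.mem_univ i)
    linarith [hB1 i (Asc ρ z)]
  · intro z
    unfold ta
    rw [dD_Asc sb, Asc_e0, dD_smul, abs_mul, abs_of_nonneg (sq_nonneg ρ), mul_comm]
    gcongr
    have : |dD e0 b (Asc ρ z)| ≤ B2 := hB2 _
    linarith
  · intro i z
    have : hs (fun z : V N => b (Asc ρ z)) i i z = ρ ^ 2 * hs b i i (Asc ρ z) := by
      have h1 : hs (fun z : V N => b (Asc ρ z)) i i = dD (e i) (fun z => ρ * gr b i (Asc ρ z)) := by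
        unfold hs
        congr 1
        funext z; exact g1 i z
      rw [h1, dD_const_mul (f := fun z => gr b i (Asc ρ z)) ((sm_gr sb i).comp (Asc ρ).contDiff), dD_Asc (sm_gr sb i), Asc_e, dD_smul]
      unfold hs gr; ring
    rw [this, abs_mul, abs_of_nonneg (sq_nonneg ρ), mul_comm]
    gcongr
    have := Finset.single_le_sum (fun i _ => p3 i) (Finset.mem_univ i)
    linarith [hB3 i (Asc ρ z)]


lemma powcut (hN : 1 ≤ N) (k : ℕ) (B : ℝ) (hB : 0 ≤ B) : ∃ K : ℝ, 0 ≤ K ∧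
    ∀ (ρ : ℝ) (ψ u : V N → ℝ), 0 < ρ → Sm ψ → (∀ z, 0 ≤ ψ z) → (∀ z, ψ z ≤ 1) →
    (∀ i z, |gr ψ i z| ≤ B * ρ) → (∀ z, |ta ψ z| ≤ B * ρ ^ 2) →
    (∀ i z, |hs ψ i i z| ≤ B * ρ ^ 2) → ∀ z,
    |∑ i, gr (fun z => ψ z ^ (k + 2)) i z * gr u i z| ≤ K * (ψ z ^ (k + 1) * (ρ * √(zz u z))) ∧
    |ta (fun z => ψ z ^ (k + 2)) z| ≤ K * (ρ ^ 2 * ψ z ^ k) ∧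
    |La (fun z => ψ z ^ (k + 2)) z| ≤ K * (ρ ^ 2 * ψ z ^ k) := by
  have hN1 : (1 : ℝ) ≤ N := by exact_mod_cast hN
  have q1 : 0 ≤ ((k : ℝ) + 2) * (B * N) := by positivity
  have q2 : 0 ≤ ((k : ℝ) + 2) * B := by positivity
  have q3 : 0 ≤ N * (((k : ℝ) + 2) * (k + 1) * B ^ 2 + (k + 2) * B) := by positivity
  refine ⟨((k : ℝ) + 2) * (B * N) + (k + 2) * B + N * ((k + 2) * (k + 1) * B ^ 2 + (k + 2) * B),
    by positivity, ?_⟩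
  intro ρ ψ u hρ hψ h0 h1 hg ht hh z
  have hz0 := h0 z
  have hz1 := h1 z
  have dpow : ∀ (n : ℕ) v z, dD v (fun z => ψ z ^ (n + 1)) z = ((n : ℝ) + 1) * ψ z ^ n * dD v ψ z := by
    intro n v z
    have := dD_comp (h := fun x => x ^ (n + 1)) hψ v z (hasDerivAt_pow (n + 1) (ψ z))
    simpa using this
  have hk1 : ψ z ^ (k + 1) ≤ ψ z ^ k := pow_le_pow_of_le_one hz0 hz1 (Nat.le_succ k)
  have hkk : 0 ≤ ψ z ^ k := by positivity
  have hzz : 0 ≤ zz u z := Finset.sum_nonneg fun i _ => mul_self_nonneg _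
  refine ⟨?_, ?_, ?_⟩
  · have e1 : ∑ i, gr (fun z => ψ z ^ (k + 2)) i z * gr u i z
        = ((k : ℝ) + 2) * ψ z ^ (k + 1) * ∑ i, gr ψ i z * gr u i z := by
      rw [Finset.mul_sum]
      refine Finset.sum_congr rfl fun i _ => ?_
      unfold gr
      rw [dpow (k + 1)]; push_cast; ring
    have e2 : |∑ i, gr ψ i z * gr u i z| ≤ B * N * (ρ * √(zz u z)) := by
      apply abs_le_of_sq_le_sq _ (by positivity)
      have cs := Finset.sum_mul_sq_le_sq_mul_sq Finset.univ (fun i => gr ψ i z) (fun i => gr u i z)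
      have e3 : ∑ i, gr ψ i z ^ 2 ≤ N * (B * ρ) ^ 2 := by
        calc ∑ i, gr ψ i z ^ 2 ≤ ∑ i : Fin N, (B * ρ) ^ 2 := Finset.sum_le_sum fun i _ => by
              rw [← sq_abs]; gcongr; exact hg i z
          _ = _ := by simp
      have e4 : ∑ i, gr u i z ^ 2 = zz u z := Finset.sum_congr rfl fun i _ => by ring
      rw [e4] at cs
      calc (∑ i, gr ψ i z * gr u i z) ^ 2 ≤ N * (B * ρ) ^ 2 * zz u z := cs.trans (by gcongr)
        _ ≤ (N * N) * (B * ρ) ^ 2 * zz u z := by gcongr; nlinarith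
        _ = (B * N * (ρ * √(zz u z))) ^ 2 := by
          rw [show (B * N * (ρ * √(zz u z))) ^ 2 = (B * N * ρ) ^ 2 * √(zz u z) ^ 2 by ring,
            Real.sq_sqrt hzz]; ring
    rw [e1, abs_mul, abs_of_nonneg (by positivity)]
    have hX : 0 ≤ ψ z ^ (k + 1) * (ρ * √(zz u z)) := by positivity
    calc ((k : ℝ) + 2) * ψ z ^ (k + 1) * |∑ i, gr ψ i z * gr u i z|
        ≤ ((k : ℝ) + 2) * ψ z ^ (k + 1) * (B * N * (ρ * √(zz u z))) := by gcongr
      _ = ((k : ℝ) + 2) * (B * N) * (ψ z ^ (k + 1) * (ρ * √(zz u z))) := by ring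
      _ ≤ _ := by apply mul_le_mul_of_nonneg_right _ hX; linarith
  · have e1 : ta (fun z => ψ z ^ (k + 2)) z = ((k : ℝ) + 2) * ψ z ^ (k + 1) * ta ψ z := by
      unfold ta; rw [dpow (k + 1)]; push_cast; ring
    rw [e1, abs_mul, abs_of_nonneg (by positivity)]
    calc ((k : ℝ) + 2) * ψ z ^ (k + 1) * |ta ψ z|
        ≤ ((k : ℝ) + 2) * ψ z ^ k * (B * ρ ^ 2) := by gcongr; exact ht z
      _ = ((k : ℝ) + 2) * B * (ρ ^ 2 * ψ z ^ k) := by ring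
      _ ≤ _ := by apply mul_le_mul_of_nonneg_right _ (by positivity); linarith
  · have e1 : ∀ i, |hs (fun z => ψ z ^ (k + 2)) i i z|
        ≤ (((k : ℝ) + 2) * (k + 1) * B ^ 2 + (k + 2) * B) * (ρ ^ 2 * ψ z ^ k) := by
      intro i
      have e2 : hs (fun z => ψ z ^ (k + 2)) i i z
          = ((k : ℝ) + 2) * (ψ z ^ (k + 1) * hs ψ i i z
            + (k + 1) * ψ z ^ k * gr ψ i z * gr ψ i z) := by
        have : dD (e i) (fun z => ψ z ^ (k + 2)) = fun z => ((k : ℝ) + 2) * (ψ z ^ (k + 1) * gr ψ i z) := by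
          funext z
          rw [dpow (k + 1)]; unfold gr; push_cast; ring
        unfold hs
        rw [this, dD_const_mul ((hψ.pow (k + 1)).mul (sm_gr hψ i)),
          dD_mul (hψ.pow (k + 1)) (sm_gr hψ i), dpow k]
        rfl
      rw [e2, abs_mul, abs_of_nonneg (by positivity)]
      have a1 : |ψ z ^ (k + 1) * hs ψ i i z| ≤ ψ z ^ k * (B * ρ ^ 2) := by
        rw [abs_mul, abs_of_nonneg (by positivity)]
        exact mul_le_mul hk1 (hh i z) (abs_nonneg _) hkk
      have a2 : |((k : ℝ) + 1) * ψ z ^ k * gr ψ i z * gr ψ i z|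
          ≤ (k + 1) * ψ z ^ k * (B * ρ) * (B * ρ) := by
        rw [abs_mul, abs_mul, abs_of_nonneg (by positivity : 0 ≤ ((k : ℝ) + 1) * ψ z ^ k)]
        have := hg i z
        gcongr
      calc ((k : ℝ) + 2) * |ψ z ^ (k + 1) * hs ψ i i z
            + (k + 1) * ψ z ^ k * gr ψ i z * gr ψ i z|
          ≤ ((k : ℝ) + 2) * (ψ z ^ k * (B * ρ ^ 2) + (k + 1) * ψ z ^ k * (B * ρ) * (B * ρ)) := by
            gcongr
            exact (abs_add_le _ _).trans (add_le_add a1 a2)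
        _ = _ := by ring
    calc |La (fun z => ψ z ^ (k + 2)) z| ≤ ∑ i, |hs (fun z => ψ z ^ (k + 2)) i i z| :=
          Finset.abs_sum_le_sum_abs _ _
      _ ≤ ∑ i : Fin N, (((k : ℝ) + 2) * (k + 1) * B ^ 2 + (k + 2) * B) * (ρ ^ 2 * ψ z ^ k) :=
          Finset.sum_le_sum fun i _ => e1 i
      _ = N * (((k : ℝ) + 2) * (k + 1) * B ^ 2 + (k + 2) * B) * (ρ ^ 2 * ψ z ^ k) := by
          simp; ring
      _ ≤ _ := by apply mul_le_mul_of_nonneg_right _ (by positivity); linarith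

lemma vol_box (N : ℕ) : ∃ κ : ℝ, 0 ≤ κ ∧ ∀ ρ : ℝ, 0 < ρ →
    (volume : Measure (V N)).real ((Metric.closedBall (0 : ℝ) (2 / ρ ^ 2)) ×ˢ
      (Metric.closedBall (0 : EuclideanSpace ℝ (Fin N)) (2 / ρ))) = κ * (1 / ρ) ^ (N + 2) := by
  refine ⟨4 * (2 ^ N * (volume : Measure (EuclideanSpace ℝ (Fin N))).real (Metric.ball 0 1)),
    by positivity, ?_⟩
  intro ρ hρ
  have : (volume : Measure (V N)) = (volume : Measure ℝ).prod volume := rfl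
  rw [this, measureReal_prod_prod, Real.volume_real_closedBall (by positivity),
    Measure.addHaar_real_closedBall _ _ (by positivity)]
  simp only [finrank_euclideanSpace, Fintype.card_fin]
  rw [div_pow, div_pow, one_pow, pow_add]
  field_simp
  ring

set_option maxHeartbeats 1000000 in
lemma ptpos (p : ℝ) (k0 : ℕ) (c C C2 C3 K ρ v q w T g l τ Gz R : ℝ) (hc : 0 < c) (hC : 0 ≤ C)
    (hC2 : 0 ≤ C2) (hC3 : 0 ≤ C3) (hK : 0 ≤ K) (hρ : 0 < ρ) (huz : 0 < v) (hzz : 0 ≤ q) (h : 0 < w)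
    (b1 : |g| ≤ K * (w ^ (k0 + 1 + 1) * (ρ * √q)))
    (b2 : |τ| ≤ K * (ρ ^ 2 * w ^ (k0 + 1)))
    (b3 : |l| ≤ K * (ρ ^ 2 * w ^ (k0 + 1)))
    (h2 : ∀ y ξ r : ℝ, 0 ≤ y → r ^ 2 = ξ * y →
      K * r * (v ^ p + |T| + y) + (K + K) * (ξ * y) + K * (ξ * v ^ p)
        ≤ c / (2 * (C + 1)) * (y ^ 2 + |T| ^ 2 + (v ^ p) ^ 2) + C2 * ξ ^ 2)
    (h3 : w ^ (k0 + 1 + 2) * (ρ ^ 2 * v / w ^ 2) ^ 2 ≤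
      c / (4 * (C * C2 + 1)) * (w ^ (k0 + 1 + 2) * (v ^ p) ^ 2) + C3 * R)
    (hz : c * (w ^ (k0 + 1 + 2) * ((q / v) ^ 2 + T ^ 2 + (v ^ p) ^ 2)) ≤
      Gz + C * (|g| * (v ^ p + |T| + q / v) + (|l| + |τ|) * q + |τ| * (v * v ^ p))) :
    c / 4 * (w ^ (k0 + 1 + 2) * (v ^ p) ^ 2) ≤ Gz + C * C2 * C3 * R := by
  set φ := w ^ (k0 + 1 + 2) with hφ
  set y := q / v with hy
  set U := v ^ p with hU
  have hUp : 0 < U := by positivity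
  have hφp : 0 < φ := by positivity
  have hy0 : 0 ≤ y := by positivity
  set ξ := ρ ^ 2 * v / w ^ 2 with hξ
  set r := ρ * √q / w with hr
  have hrr : r ^ 2 = ξ * y := by
    rw [hr, hξ, hy, div_pow, mul_pow, Real.sq_sqrt hzz]; field_simp
  have f1 : w ^ (k0 + 1 + 1) * (ρ * √q) = φ * r := by
    rw [hφ, hr, pow_succ _ (k0 + 1 + 1)]; field_simp
  have f2 : ρ ^ 2 * w ^ (k0 + 1) * q = φ * (ξ * y) := by
    rw [hφ, hξ, hy, pow_add _ (k0 + 1) 2]; field_simp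
  have f3 : ρ ^ 2 * w ^ (k0 + 1) * (v * U) = φ * (ξ * U) := by
    rw [hφ, hξ, pow_add _ (k0 + 1) 2]; field_simp
  rw [f1] at b1
  have hV := abs_nonneg (T)
  have E1 : |g| * (U + |T| + y)
      ≤ φ * (K * r * (U + |T| + y)) := by
    refine (mul_le_mul_of_nonneg_right b1 (by positivity)).trans_eq ?_; ring
  have E2 : (|l| + |τ|)
      * q ≤ φ * ((K + K) * (ξ * y)) := by
    refine (mul_le_mul_of_nonneg_right (add_le_add b3 b2) hzz).trans_eq ?_
    linear_combination (K + K) * f2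
  have E3 : |τ| * (v * U) ≤ φ * (K * (ξ * U)) := by
    refine (mul_le_mul_of_nonneg_right b2 (by positivity)).trans_eq ?_
    linear_combination K * f3
  have Y := mul_le_mul_of_nonneg_left (h2 y ξ r hy0 hrr) hφp.le
  rw [sq_abs] at Y
  have Y3 := h3
  set Q := φ * (y ^ 2 + T ^ 2 + U ^ 2) with hQ
  have hQ0 : 0 ≤ Q := by positivity
  have hE := add_le_add (add_le_add E1 E2) E3
  have hE' := mul_le_mul_of_nonneg_left (hE.trans (by linarith [Y] :
    _ ≤ c / (2 * (C + 1)) * Q + C2 * (φ * ξ ^ 2))) hC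
  have z1 : C * (c / (2 * (C + 1)) * Q) ≤ c / 2 * Q := by
    have : C * (c / (2 * (C + 1)) * Q) = c / 2 * Q * (C / (C + 1)) := by field_simp
    rw [this]
    apply mul_le_of_le_one_right (by positivity)
    rw [div_le_one (by positivity)]; linarith
  have Y3' := mul_le_mul_of_nonneg_left Y3 (show 0 ≤ C * C2 by positivity)
  have z2 : C * C2 * (c / (4 * (C * C2 + 1)) * (φ * U ^ 2)) ≤ c / 4 * (φ * U ^ 2) := by
    have : C * C2 * (c / (4 * (C * C2 + 1)) * (φ * U ^ 2))
      = c / 4 * (φ * U ^ 2) * (C * C2 / (C * C2 + 1)) := by field_simp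
    rw [this]
    apply mul_le_of_le_one_right (by positivity)
    rw [div_le_one (by positivity)]; linarith
  have z3 : φ * U ^ 2 ≤ Q := by
    rw [hQ]; gcongr; linarith [sq_nonneg y, sq_nonneg T]
  have z4 := mul_le_mul_of_nonneg_left z3 (show 0 ≤ c / 2 by positivity)
  rw [mul_add] at hE' Y3'
  linarith

set_option maxHeartbeats 1000000 in
lemma nonexist (hN : 1 ≤ N) (p : ℝ) (hp : 1 < p) (hpN : p * ((N : ℝ) - 1) < N + 3)
    (u : V N → ℝ) (hu : Sm u) (hpos : ∀ z, 0 < u z)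
    (hsol : ∀ z, ta u z = La u z + u z ^ p) : False := by
  have hN1 : (1 : ℝ) ≤ N := by exact_mod_cast hN
  have hp1 : 0 < p - 1 := by linarith
  obtain ⟨s, hs0, hs1, hs2⟩ : ∃ s : ℝ, 0 < s ∧ s * ((N : ℝ) - 1) < N ∧
      p * ((N : ℝ) - 1) < s * (N + 2) := by
    refine ⟨(N + 3) / (N + 2), by positivity, ?_, ?_⟩
    · rw [div_mul_eq_mul_div, div_lt_iff₀ (by positivity)]; nlinarith
    · rw [div_mul_cancel₀ _ (by positivity)]; exact hpN
  obtain ⟨c, C, hc, hC, hcore⟩ := core hN p s hp hs0 hs1 hs2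
  obtain ⟨k0, hk0⟩ := exists_nat_ge (4 * p / (p - 1))
  obtain ⟨B, hB, hcut⟩ := cutoff N
  obtain ⟨K, hK, hpc⟩ := powcut hN (k0 + 1) B hB
  obtain ⟨C2, hC2, h2⟩ := alg2 K (c / (2 * (C + 1))) (by positivity)
  obtain ⟨C3, hC3, h3⟩ := alg3 p hp (k0 + 1 + 2) (by push_cast; linarith)
    (c / (4 * (C * C2 + 1))) (by positivity)
  obtain ⟨κ, hκ, hvol⟩ := vol_box N
  let b : ContDiffBump (0 : V N) := ⟨1 / 2, 1, by norm_num, by norm_num⟩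
  have cU : Continuous (fun z => (u z ^ p) ^ 2) := ((sm_rpow hu hpos p).pow 2).continuous
  have hδ : 0 < ∫ z, b z * (u z ^ p) ^ 2 := by
    refine Continuous.integral_pos_of_hasCompactSupport_nonneg_nonzero (x := 0)
      (b.continuous.mul cU) (b.hasCompactSupport.mul_right) ?_ ?_
    · intro z
      have := hpos z
      have := b.nonneg' z
      change 0 ≤ b z * (u z ^ p) ^ 2
      positivity
    · have h1 : b 0 = 1 := b.one_of_mem_closedBall (by
        rw [mem_closedBall_zero_iff, norm_zero]; change (0 : ℝ) ≤ 1 / 2; norm_num)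
      have := hpos 0
      rw [h1]; positivity
  have main : ∀ ρ : ℝ, 0 < ρ → ρ ≤ 1 → c / 4 * ∫ z, b z * (u z ^ p) ^ 2 ≤
      C * C2 * C3 * κ * ρ ^ (4 * p / (p - 1) - (N + 2)) := by
    intro ρ hρ hρ1
    obtain ⟨ψ, sψ, cψ, h0ψ, h1ψ, hψ1, hsupp, hg, ht, hh⟩ := hcut ρ hρ hρ1
    have sφ : Sm (fun z => ψ z ^ (k0 + 1 + 2)) := sψ.pow _
    have cφ : HasCompactSupport (fun z => ψ z ^ (k0 + 1 + 2)) := by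
      refine cψ.comp_left (g := fun x => x ^ (k0 + 1 + 2)) ?_
      simp
    have φ0 : ∀ z, 0 ≤ ψ z ^ (k0 + 1 + 2) := fun z => pow_nonneg (h0ψ z) _
    obtain ⟨G, hG, hpt⟩ := hcore u _ hu hpos hsol sφ cφ φ0
    set S := (Metric.closedBall (0 : ℝ) (2 / ρ ^ 2)) ×ˢ
      (Metric.closedBall (0 : EuclideanSpace ℝ (Fin N)) (2 / ρ)) with hS
    have pt : ∀ z, c / 4 * (ψ z ^ (k0 + 1 + 2) * (u z ^ p) ^ 2) ≤
        G z + S.indicator (fun _ => C * C2 * C3 * ρ ^ (4 * p / (p - 1))) z := by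
      intro z
      obtain ⟨b1, b2, b3⟩ := hpc ρ ψ u hρ sψ h0ψ h1ψ hg ht hh z
      have hz := hpt z
      have huz := hpos z
      have hzz : 0 ≤ zz u z := Finset.sum_nonneg fun i _ => mul_self_nonneg _
      have hD : 0 ≤ C * C2 * C3 * ρ ^ (4 * p / (p - 1)) := by positivity
      rcases (h0ψ z).eq_or_lt with h | h
      · have hi : 0 ≤ S.indicator (fun _ => C * C2 * C3 * ρ ^ (4 * p / (p - 1))) z :=
          Set.indicator_nonneg (fun _ _ => hD) z
        rw [← h] at b1 b2 b3 hz ⊢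
        simp only [ne_eq, Nat.add_eq_zero_iff, one_ne_zero, and_false, not_false_eq_true, zero_pow,
          zero_mul, mul_zero, OfNat.ofNat_ne_zero] at b1 b2 b3 hz ⊢
        have b1' := le_antisymm b1 (abs_nonneg _)
        have b2' := le_antisymm b2 (abs_nonneg _)
        have b3' := le_antisymm b3 (abs_nonneg _)
        rw [b1', b2', b3'] at hz
        simp at hz
        linarith
      · rw [Set.indicator_of_mem (hsupp z h.ne')]
        exact ptpos p k0 c C C2 C3 K ρ (u z) (zz u z) (ψ z) (ta u z) _ _ _ (G z) _ hc hC hC2 hC3 hK hρ huz hzz h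
          b1 b2 b3 (h2 _ _) (h3 (u z) ρ (ψ z) huz hρ h (h1ψ z)) hz
    have hSm : MeasurableSet S := (Metric.isClosed_closedBall.prod Metric.isClosed_closedBall).measurableSet
    have hSc : IsCompact S := (isCompact_closedBall _ _).prod (isCompact_closedBall _ _)
    have hSf : (volume : Measure (V N)) S ≠ ⊤ := hSc.measure_lt_top.ne
    have iφ : Integrable (fun z => ψ z ^ (k0 + 1 + 2) * (u z ^ p) ^ 2) :=
      (sφ.continuous.mul cU).integrable_of_hasCompactSupport cφ.mul_right
    have ib : Integrable (fun z => b z * (u z ^ p) ^ 2) :=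
      (b.continuous.mul cU).integrable_of_hasCompactSupport b.hasCompactSupport.mul_right
    have iI : Integrable (S.indicator (fun _ : V N => C * C2 * C3 * ρ ^ (4 * p / (p - 1)))) :=
      (integrableOn_const (hs := hSf)).integrable_indicator hSm
    have s1 : ∫ z, b z * (u z ^ p) ^ 2 ≤ ∫ z, ψ z ^ (k0 + 1 + 2) * (u z ^ p) ^ 2 := by
      apply integral_mono ib iφ
      intro z
      apply mul_le_mul_of_nonneg_right _ (sq_nonneg _)
      by_cases hz : z ∈ Metric.closedBall (0 : V N) 1
      · rw [hψ1 z hz, one_pow]; exact b.le_one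
      · rw [b.zero_of_le_dist]
        · exact φ0 z
        · rw [Metric.mem_closedBall, not_le] at hz; exact hz.le
    have s2 : ∫ z, c / 4 * (ψ z ^ (k0 + 1 + 2) * (u z ^ p) ^ 2) ≤
        ∫ z, (G z + S.indicator (fun _ => C * C2 * C3 * ρ ^ (4 * p / (p - 1))) z) :=
      integral_mono (iφ.const_mul _) (hG.1.add iI) pt
    rw [integral_const_mul, integral_add hG.1 iI, hG.2, zero_add, integral_indicator hSm,
      setIntegral_const, hS, hvol ρ hρ, smul_eq_mul] at s2
    refine (mul_le_mul_of_nonneg_left s1 (by positivity)).trans (s2.trans_eq ?_)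
    rw [Real.rpow_sub hρ, show ((N : ℝ) + 2) = ((N + 2 : ℕ) : ℝ) by push_cast; ring,
      Real.rpow_natCast, div_pow, one_pow]
    field_simp
  have hη : 0 < 4 * p / (p - 1) - (N + 2) := by
    rw [sub_pos, lt_div_iff₀ hp1]; nlinarith
  have lim : Filter.Tendsto (fun ρ : ℝ => C * C2 * C3 * κ * ρ ^ (4 * p / (p - 1) - (N + 2)))
      (nhdsWithin 0 (Set.Ioi 0)) (nhds 0) := by
    have h1 : Filter.Tendsto (fun ρ : ℝ => ρ ^ (4 * p / (p - 1) - (N + 2)))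
        (nhds 0) (nhds 0) := by
      have := (Real.continuousAt_rpow_const 0 (4 * p / (p - 1) - (N + 2)) (Or.inr hη.le)).tendsto
      rwa [Real.zero_rpow hη.ne'] at this
    have := (h1.mono_left (nhdsWithin_le_nhds (s := Set.Ioi 0))).const_mul (C * C2 * C3 * κ)
    rwa [mul_zero] at this
  have hle := ge_of_tendsto lim (b := c / 4 * ∫ z, b z * (u z ^ p) ^ 2) (by
    filter_upwards [Ioc_mem_nhdsGT (show (0 : ℝ) < 1 by norm_num)] with ρ hρ
    exact main ρ hρ.1 hρ.2)
  have : 0 < c / 4 * ∫ z, b z * (u z ^ p) ^ 2 := by positivity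
  linarith

lemma slice {f : V N → ℝ} (hf : Sm f) (t : ℝ) (x w : EuclideanSpace ℝ (Fin N)) :
    fderiv ℝ (fun y => f (t, y)) x w = fderiv ℝ f (t, x) (0, w) := by
  have := ((hf.dA (t, x)).hasFDerivAt.comp x (hasFDerivAt_prodMk_right t x)).fderiv
  change fderiv ℝ (f ∘ fun y => (t, y)) x w = _
  rw [this]; simp

lemma slap_eq {u : V N → ℝ} (hu : Sm u) (t : ℝ) (x : EuclideanSpace ℝ (Fin N)) :
    slap u t x = La u (t, x) := by
  unfold slap lap La pd2 hs
  refine Finset.sum_congr rfl fun i _ => ?_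
  have : (fun y => fderiv ℝ (fun y => u (t, y)) y (EuclideanSpace.single i 1))
      = fun y => dD (e i) u (t, y) := by
    funext y; rw [slice hu]; rfl
  rw [this, slice (hu.dD (e i))]; rfl

lemma partialT_eq {u : V N → ℝ} (hu : Sm u) (t : ℝ) (x : EuclideanSpace ℝ (Fin N)) :
    partialT u t x = ta u (t, x) := by
  unfold partialT ta dD e0
  have := ((hu.dA (t, x)).hasFDerivAt.comp t (hasFDerivAt_prodMk_left (𝕜 := ℝ) t x)).fderiv
  change deriv (u ∘ fun s => (s, x)) t = _
  rw [← fderiv_apply_one_eq_deriv, this]; simp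

lemma pStar_bound (hN : 1 ≤ N) (hp' : p < pStar N) : p * ((N : ℝ) - 1) < N + 3 := by
  unfold pStar at hp'
  split_ifs at hp' with h
  · have h2 : (2 : ℝ) ≤ N := by exact_mod_cast h
    rw [lt_div_iff₀ (by linarith)] at hp'
    have : √((N : ℝ) ^ 2 + 8 * N) < N + 4 := by
      rw [Real.sqrt_lt' (by linarith)]; nlinarith
    linarith
  · have : N = 1 := by omega
    subst this; norm_num

end LY


/-- Li–Yau type inequality for the semilinear heat equation (Euclidean case, `K = 0`):
there are `β, γ > 0` depending only on `N, p` such that every positive entire solution of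
`∂ₜ u = Δu + uᵖ` satisfies `‖∇u/u‖² − γ ∂ₜ(log u) + β u^{p−1} ≤ 0` everywhere. -/
theorem li_yau_semilinear_euclidean {N : ℕ} (hN : 1 ≤ N) (p : ℝ) (hp : 1 < p)
    (hp' : p < pStar N) :
    ∃ β γ : ℝ, 0 < β ∧ 0 < γ ∧
      ∀ u : ℝ × EuclideanSpace ℝ (Fin N) → ℝ, ContDiff ℝ (⊤ : ℕ∞) u → (∀ z, 0 < u z) →
        (∀ t x, partialT u t x = slap u t x + u (t, x) ^ p) →
        ∀ t x, (‖sgrad u t x‖ / u (t, x)) ^ 2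
          - γ * partialT (fun z => Real.log (u z)) t x + β * u (t, x) ^ (p - 1) ≤ 0 := by
  refine ⟨1, 1, one_pos, one_pos, fun u hu hpos hsol t x => ?_⟩
  exact (LY.nonexist hN p hp (LY.pStar_bound hN hp') u hu hpos (fun z => by
    have := hsol z.1 z.2
    rwa [LY.partialT_eq hu, LY.slap_eq hu] at this)).elim
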